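/- arXiv:1705.10743 — 7 statements merged into one kernel-verified Lean document; each statement's English description precedes it below -/
import Mathlib

section
/- Non-vanishing minimax bias of the sample Wasserstein gradient: for every m ≥ 1 there exist parameters θ*, θ ∈ (0,1) such that, for X₁, …, X_m i.i.d. with law B(θ*) and θ̂ = (1/m)∑ᵢ Xᵢ, one has |sign(θ − θ*) − E[sign(θ − θ̂)]| ≥ 2e^{−2}. -/
open MeasureTheory

/-- The Bernoulli measure on `ℝ` with parameter `θ`: mass `θ` at `1` and mass `1 - θ` at `0`. -/
noncomputable def bernoulliReal (θ : ℝ) : Measure ℝ :=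
  ENNReal.ofReal θ • Measure.dirac 1 + ENNReal.ofReal (1 - θ) • Measure.dirac 0

/-- The empirical mean `θ̂ = (1/m) ∑ᵢ Xᵢ` of a sample vector `X : Fin m → ℝ`. -/
noncomputable def empMean {m : ℕ} (X : Fin m → ℝ) : ℝ :=
  (∑ i, X i) / m

theorem measurable_realSign : Measurable Real.sign :=
  Measurable.ite measurableSet_Iio measurable_const
    (Measurable.ite measurableSet_Ioi measurable_const measurable_const)

theorem abs_realSign_le_one (x : ℝ) : |Real.sign x| ≤ 1 := by
  rcases Real.sign_apply_eq x with h | h | h <;> simp [h]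

theorem measurable_empMean {m : ℕ} : Measurable (empMean : (Fin m → ℝ) → ℝ) := by
  unfold empMean
  fun_prop

theorem empMean_one {m : ℕ} (hm : 1 ≤ m) : empMean (1 : Fin m → ℝ) = 1 := by
  have : (m : ℝ) ≠ 0 := by positivity
  simp [empMean, this]

theorem isProbabilityMeasure_bernoulliReal {p : ℝ} (h0 : 0 ≤ p) (h1 : p ≤ 1) :
    IsProbabilityMeasure (bernoulliReal p) :=
  ⟨by simp [bernoulliReal, ← ENNReal.ofReal_add h0 (sub_nonneg.2 h1)]⟩

theorem bernoulliReal_singleton_one (p : ℝ) : bernoulliReal p {1} = ENNReal.ofReal p := by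
  simp [bernoulliReal]

/-- The sample consisting only of ones has probability `p ^ m`. -/
theorem pi_bernoulliReal_singleton_one {m : ℕ} {p : ℝ} (h0 : 0 ≤ p) (h1 : p ≤ 1) :
    (Measure.pi fun _ : Fin m => bernoulliReal p).real {1} = p ^ m := by
  have := isProbabilityMeasure_bernoulliReal h0 h1
  rw [measureReal_def, Measure.pi_singleton]
  simp [bernoulliReal_singleton_one, h0]

theorem integral_sign_sub_empMean_le {m : ℕ} (hm : 1 ≤ m) {p t : ℝ} (h0 : 0 ≤ p) (h1 : p ≤ 1)
    (ht : t < 1) :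
    ∫ X, Real.sign (t - empMean X) ∂(Measure.pi fun _ : Fin m => bernoulliReal p) ≤
      1 - 2 * p ^ m := by
  have := isProbabilityMeasure_bernoulliReal h0 h1
  set μ := Measure.pi fun _ : Fin m => bernoulliReal p with hμ
  have hA : MeasurableSet ({1} : Set (Fin m → ℝ)) := measurableSet_singleton 1
  have hind : Integrable (({1} : Set (Fin m → ℝ)).indicator fun _ => (2 : ℝ)) μ :=
    (integrable_const 2).indicator hA
  have hsign : Integrable (fun X : Fin m → ℝ => Real.sign (t - empMean X)) μ :=
    Integrable.of_bound
      (measurable_realSign.comp (measurable_const.sub measurable_empMean)).aestronglyMeasurable 1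
      (.of_forall fun X => abs_realSign_le_one _)
  calc ∫ X, Real.sign (t - empMean X) ∂μ
      ≤ ∫ X, (1 - ({1} : Set (Fin m → ℝ)).indicator (fun _ => (2 : ℝ)) X) ∂μ := by
        refine integral_mono hsign ((integrable_const 1).sub hind) fun X => ?_
        by_cases hX : X = 1
        · subst hX
          simp only [empMean_one hm, Real.sign_of_neg (sub_neg.2 ht), Set.mem_singleton_iff,
            Set.indicator_of_mem]
          norm_num
        · simpa [hX] using (abs_le.1 (abs_realSign_le_one (t - empMean X))).2
    _ = 1 - 2 * p ^ m := by
        rw [integral_sub (integrable_const 1) hind, integral_indicator_const _ hA,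
          pi_bernoulliReal_singleton_one h0 h1]
        simp [mul_comm]

/-- Non-vanishing minimax bias of the sample Wasserstein gradient: for every `m ≥ 1` there
exist Bernoulli parameters `θ*, θ ∈ (0,1)` such that, for `X₁, …, X_m` i.i.d. from `B(θ*)`,
`|sign(θ - θ*) - E[sign(θ - θ̂)]| ≥ 2 e⁻²`. -/
theorem wasserstein_minimax_bias (m : ℕ) (hm : 1 ≤ m) :
    ∃ θstar θ : ℝ, θstar ∈ Set.Ioo (0:ℝ) 1 ∧ θ ∈ Set.Ioo (0:ℝ) 1 ∧
      2 * Real.exp (-2) ≤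
        |Real.sign (θ - θstar) -
          ∫ X, Real.sign (θ - empMean X)
            ∂(Measure.pi fun _ : Fin m => bernoulliReal θstar)| := by
  have hm' : (0 : ℝ) < m := by positivity
  set p := Real.exp (-2 / m) with hp
  have hp0 : 0 < p := Real.exp_pos _
  have hp1 : p < 1 := Real.exp_lt_one_iff.2 (div_neg_of_neg_of_pos (by norm_num) hm')
  have hpm : p ^ m = Real.exp (-2) := by
    rw [hp, ← Real.exp_nat_mul, mul_div_cancel₀ _ hm'.ne']
  refine ⟨p, (p + 1) / 2, ⟨hp0, hp1⟩, ⟨by linarith, by linarith⟩, le_trans ?_ (le_abs_self _)⟩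
  rw [Real.sign_of_pos (by linarith)]
  have h := integral_sign_sub_empMean_le hm hp0.le hp1.le (t := (p + 1) / 2) (by linarith)
  rw [hpm] at h
  linarith
end

section
/- For a single sample (m = 1) the expected sample Wasserstein gradient does not depend on θ: if X₁ has law B(θ*) with θ* ∈ (0,1), then for every θ ∈ (0,1), E[sign(θ − X₁)] = 1 − 2θ*. -/
open MeasureTheory

/-- For a single sample (`m = 1`) the expected sample Wasserstein gradient does not depend
on `θ`: if `X₁ ∼ B(θ*)`, then `E[sign(θ - X₁)] = 1 - 2 θ*` for every `θ ∈ (0,1)`. -/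
theorem one_sample_wasserstein_gradient (θstar : ℝ) (hθstar : θstar ∈ Set.Ioo (0:ℝ) 1)
    (θ : ℝ) (hθ : θ ∈ Set.Ioo (0:ℝ) 1) :
    ∫ x, Real.sign (θ - x) ∂(bernoulliReal θstar) = 1 - 2 * θstar := by
  obtain ⟨h0, h1⟩ := hθstar
  have hint (c a : ℝ) :
      Integrable (fun x => Real.sign (θ - x)) (ENNReal.ofReal c • Measure.dirac a) :=
    (integrable_dirac (by simp)).smul_measure ENNReal.ofReal_ne_top
  rw [bernoulliReal, integral_add_measure (hint _ _) (hint _ _), integral_smul_measure,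
    integral_smul_measure, integral_dirac, integral_dirac,
    Real.sign_of_neg (sub_neg.2 hθ.2), Real.sign_of_pos (sub_pos.2 hθ.1),
    ENNReal.toReal_ofReal h0.le, ENNReal.toReal_ofReal (sub_nonneg.2 h1.le), smul_eq_mul,
    smul_eq_mul]
  ring
end

section
/- Non-vanishing bias away from the boundary: let m ≥ 1 and let X₁, …, X_m be i.i.d. with law B(1/2) and θ̂ = (1/m)∑ᵢ Xᵢ. Then for every θ with 1/2 < θ < 1/2 + 1/√(8m), one has 2·Pr{θ̂ ≥ θ} ≥ 1/6; equivalently, the bias sign(θ − 1/2) − E[sign(θ − θ̂)] is at least 1/6. -/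
open MeasureTheory

/-- The central binomial coefficient is at most `4 ^ n / √(3 n + 1)`. -/
theorem three_mul_add_one_mul_centralBinom_sq_le (n : ℕ) :
    (3 * n + 1) * n.centralBinom ^ 2 ≤ 16 ^ n := by
  induction n with
  | zero => simp
  | succ k ih =>
    have h := Nat.succ_mul_centralBinom_succ k
    have hpoly : (3 * (k + 1) + 1) * (2 * (2 * k + 1)) ^ 2 ≤ 16 * (k + 1) ^ 2 * (3 * k + 1) := by
      nlinarith
    refine le_of_mul_le_mul_left (a := (k + 1) ^ 2) ?_ (pow_pos k.succ_pos 2)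
    calc (k + 1) ^ 2 * ((3 * (k + 1) + 1) * (k + 1).centralBinom ^ 2)
        = (3 * (k + 1) + 1) * ((k + 1) * (k + 1).centralBinom) ^ 2 := by ring
      _ = (3 * (k + 1) + 1) * (2 * (2 * k + 1)) ^ 2 * k.centralBinom ^ 2 := by rw [h]; ring
      _ ≤ 16 * (k + 1) ^ 2 * (3 * k + 1) * k.centralBinom ^ 2 := by gcongr
      _ = 16 * (k + 1) ^ 2 * ((3 * k + 1) * k.centralBinom ^ 2) := by ring
      _ ≤ 16 * (k + 1) ^ 2 * 16 ^ k := by gcongr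
      _ = (k + 1) ^ 2 * 16 ^ (k + 1) := by ring

/-- The middle binomial coefficient of `m` is at most `2 ^ m / √(3 m / 2 + 1)`. -/
theorem three_mul_add_two_mul_choose_half_sq_le (m : ℕ) :
    (3 * m + 2) * m.choose (m / 2) ^ 2 ≤ 2 * 4 ^ m := by
  obtain ⟨k, rfl | rfl⟩ := m.even_or_odd'
  · have h := three_mul_add_one_mul_centralBinom_sq_le k
    rw [Nat.mul_div_cancel_left k two_pos, ← Nat.centralBinom_eq_two_mul_choose, pow_mul]
    norm_num
    linarith
  · have h := three_mul_add_one_mul_centralBinom_sq_le (k + 1)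
    have hc : (k + 1).centralBinom = 2 * (2 * k + 1).choose k := by
      rw [Nat.centralBinom_eq_two_mul_choose, show 2 * (k + 1) = 2 * k + 1 + 1 by ring,
        Nat.choose_succ_succ, Nat.choose_symm_half]
      ring
    rw [hc, pow_succ 16 k] at h
    rw [show (2 * k + 1) / 2 = k by lia, pow_succ 4 (2 * k), pow_mul]
    norm_num
    nlinarith [sq_nonneg ((2 * k + 1).choose k)]

/-- A window of `d + 1` consecutive binomial coefficients of `m`, with `2 d² < m`, carries at most
`5 / 6` of the total mass `2 ^ m`. -/
theorem window_mul_choose_half_le {m d : ℕ} (hd : 2 * d ^ 2 < m) :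
    6 * ((d + 1) * m.choose (m / 2)) ≤ 5 * 2 ^ m := by
  by_cases hm : m = 3 ∧ d = 1
  · obtain ⟨rfl, rfl⟩ := hm
    decide
  have hquad : 72 * (d + 1) ^ 2 ≤ 25 * (3 * m + 2) := by
    rcases lt_or_ge d 2 with h | h
    · interval_cases d <;> lia
    · nlinarith
  have hsq : (6 * ((d + 1) * m.choose (m / 2))) ^ 2 ≤ (5 * 2 ^ m) ^ 2 := by
    have h := three_mul_add_two_mul_choose_half_sq_le m
    have h' := Nat.mul_le_mul_right (m.choose (m / 2) ^ 2) hquad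
    have hpow : ((2 : ℕ) ^ m) ^ 2 = 4 ^ m := by rw [← pow_mul, mul_comm, pow_mul]; norm_num
    rw [mul_pow 5, hpow]
    nlinarith
  exact (Nat.pow_le_pow_iff_left two_ne_zero).mp hsq

/-- The number of subsets whose cardinality lies strictly between `m - K` and `K`. -/
theorem card_filter_card_window_le {m c K : ℕ} (hc : m + 1 + c = 2 * K) :
    (Finset.univ.filter fun s : Finset (Fin m) => s.card < K ∧ m < s.card + K).card ≤
      c * m.choose (m / 2) := by
  have hmaps : ∀ s ∈ Finset.univ.filter
      (fun s : Finset (Fin m) => s.card < K ∧ m < s.card + K),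
      s.card ∈ Finset.Ico (m + 1 - K) K := by
    intro s hs
    simp only [Finset.mem_filter, Finset.mem_univ, true_and] at hs
    rw [Finset.mem_Ico]
    lia
  rw [Finset.card_eq_sum_card_fiberwise hmaps]
  calc _ ≤ ∑ _k ∈ Finset.Ico (m + 1 - K) K, m.choose (m / 2) := by
        refine Finset.sum_le_sum fun k _ => le_trans ?_ (Nat.choose_le_middle k m)
        calc _ ≤ (Finset.powersetCard k (Finset.univ : Finset (Fin m))).card := by
              refine Finset.card_le_card fun s hs => ?_
              rw [Finset.mem_filter] at hs
              exact Finset.mem_powersetCard.mpr ⟨Finset.subset_univ s, hs.2⟩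
          _ = m.choose k := by simp
    _ = (K - (m + 1 - K)) * m.choose (m / 2) := by simp
    _ ≤ c * m.choose (m / 2) := Nat.mul_le_mul_right _ (by lia)

/-- Splitting all subsets by cardinality, with the two tails exchanged by complementation. -/
theorem two_pow_le_two_mul_card_tail {m c K : ℕ} (hc : m + 1 + c = 2 * K) :
    2 ^ m ≤ 2 * (Finset.univ.filter fun s : Finset (Fin m) => K ≤ s.card).card +
      c * m.choose (m / 2) := by
  have hcompl : (Finset.univ.filter fun s : Finset (Fin m) => s.card + K ≤ m).card ≤
      (Finset.univ.filter fun s : Finset (Fin m) => K ≤ s.card).card := by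
    refine Finset.card_le_card_of_injOn compl (fun s hs => ?_) compl_injective.injOn
    simp only [Finset.coe_filter, Finset.mem_univ, true_and, Set.mem_ofPred_eq,
      Finset.card_compl, Fintype.card_fin] at hs ⊢
    lia
  have hcover : (Finset.univ : Finset (Finset (Fin m))) ⊆
      ((Finset.univ.filter fun s => K ≤ s.card) ∪ Finset.univ.filter fun s => s.card + K ≤ m) ∪
        Finset.univ.filter fun s => s.card < K ∧ m < s.card + K := by
    intro s _
    simp only [Finset.mem_union, Finset.mem_filter, Finset.mem_univ, true_and]
    lia
  have hcard := (Finset.card_le_card hcover).trans (Finset.card_union_le _ _)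
  have hunion := Finset.card_union_le
    (Finset.univ.filter fun s : Finset (Fin m) => K ≤ s.card)
    (Finset.univ.filter fun s : Finset (Fin m) => s.card + K ≤ m)
  have hwindow := card_filter_card_window_le hc
  rw [Finset.card_univ, Fintype.card_finset, Fintype.card_fin] at hcard
  lia

theorem two_pow_le_twelve_mul_card_tail {m K : ℕ} (hK : m < 2 * K)
    (hd : ∀ d, m + 2 + d = 2 * K → 2 * d ^ 2 < m) :
    2 ^ m ≤ 12 * (Finset.univ.filter fun s : Finset (Fin m) => K ≤ s.card).card := by
  obtain ⟨c, hc⟩ := Nat.exists_eq_add_of_lt hK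
  have htail := two_pow_le_two_mul_card_tail (m := m) (c := c) (K := K) (by lia)
  cases c with
  | zero => lia
  | succ d =>
    have := window_mul_choose_half_le (hd d (by lia))
    lia

/-- The fair coin on `Bool`. -/
noncomputable def fairCoin : Measure Bool :=
  (2⁻¹ : ENNReal) • Measure.dirac true + (2⁻¹ : ENNReal) • Measure.dirac false

theorem fairCoin_singleton (b : Bool) : fairCoin {b} = 2⁻¹ := by
  cases b <;> simp [fairCoin]

instance : IsProbabilityMeasure fairCoin := by
  constructor
  simp [fairCoin, ENNReal.inv_two_add_inv_two]

theorem map_fairCoin :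
    fairCoin.map (fun b => if b then (1 : ℝ) else 0) = bernoulliReal (1 / 2) := by
  have hhalf : ENNReal.ofReal (1 / 2) = 2⁻¹ := by
    rw [one_div, ENNReal.ofReal_inv_of_pos two_pos, ENNReal.ofReal_ofNat]
  have hmeas : Measurable (fun b : Bool => if b then (1 : ℝ) else 0) := measurable_of_finite _
  rw [fairCoin, bernoulliReal, Measure.map_add _ _ hmeas, Measure.map_smul, Measure.map_smul,
    Measure.map_dirac' hmeas, Measure.map_dirac' hmeas, show (1 : ℝ) - 1 / 2 = 1 / 2 by norm_num,
    hhalf]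
  simp

instance : IsProbabilityMeasure (bernoulliReal (1 / 2)) := by
  rw [← map_fairCoin]
  exact Measure.isProbabilityMeasure_map (measurable_of_finite _).aemeasurable

/-- The empirical mean of `m` fair coin flips is at least `θ` on all outcomes with at least
`⌈m θ⌉` ones. -/
theorem card_tail_div_le_measure_empMean {m K : ℕ} (hm : 1 ≤ m) {θ : ℝ} (hK : m * θ ≤ K) :
    ((Finset.univ.filter fun s : Finset (Fin m) => K ≤ s.card).card : ENNReal) * 2⁻¹ ^ m ≤
      (Measure.pi fun _ : Fin m => bernoulliReal (1 / 2)) {X | θ ≤ empMean X} := by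
  have hm' : (0 : ℝ) < m := by exact_mod_cast hm
  have hpi := Measure.pi_map_pi (μ := fun _ : Fin m => fairCoin)
    (f := fun _ b => if b then (1 : ℝ) else 0)
    (hμ := fun _ => by rw [map_fairCoin]; infer_instance)
    (fun _ => (measurable_of_finite _).aemeasurable)
  simp only [map_fairCoin] at hpi
  rw [← hpi, Measure.map_apply (measurable_of_finite _)
    (measurableSet_le measurable_const measurable_empMean)]
  let U : Finset (Fin m) ↪ (Fin m → Bool) :=
    ⟨fun s i => decide (i ∈ s), fun s t h => by
      ext i
      simpa using congrFun h i⟩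
  set T := Finset.univ.filter fun s : Finset (Fin m) => K ≤ s.card
  calc (T.card : ENNReal) * 2⁻¹ ^ m
      = ∑ x ∈ T.map U, (Measure.pi fun _ : Fin m => fairCoin) {x} := by
        simp [Measure.pi_singleton, fairCoin_singleton]
    _ = (Measure.pi fun _ : Fin m => fairCoin) (T.map U) := sum_measure_singleton
    _ ≤ _ := by
        refine measure_mono fun x hx => ?_
        obtain ⟨s, hs, rfl⟩ := Finset.mem_map.mp (Finset.mem_coe.mp hx)
        have hs' : (K : ℝ) ≤ s.card := by exact_mod_cast (Finset.mem_filter.mp hs).2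
        have hsum : (∑ i, if U s i = true then (1 : ℝ) else 0) = s.card := by
          have hU (i : Fin m) : U s i = decide (i ∈ s) := rfl
          simp [hU]
        simp only [Set.mem_preimage, Set.mem_ofPred_eq, empMean]
        rw [le_div_iff₀ hm', hsum]
        linarith

/-- Anti-concentration of the empirical mean of fair coin flips. -/
theorem one_div_twelve_le_measure_empMean {m : ℕ} (hm : 1 ≤ m) {θ : ℝ}
    (hθ₁ : 1 / 2 < θ) (hθ₂ : θ < 1 / 2 + 1 / Real.sqrt (8 * m)) :
    1 / 12 ≤
      ((Measure.pi fun _ : Fin m => bernoulliReal (1 / 2)) {X | θ ≤ empMean X}).toReal := by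
  have hm' : (0 : ℝ) < m := by exact_mod_cast hm
  have hK := Nat.le_ceil ((m : ℝ) * θ)
  have hK' := Nat.ceil_lt_add_one (a := (m : ℝ) * θ) (by positivity)
  set K := ⌈(m : ℝ) * θ⌉₊
  have hcard : 2 ^ m ≤ 12 * (Finset.univ.filter fun s : Finset (Fin m) => K ≤ s.card).card := by
    refine two_pow_le_twelve_mul_card_tail ?_ fun d hd => ?_
    · have : (m : ℝ) < 2 * K := by nlinarith
      exact_mod_cast this
    · set r := Real.sqrt (8 * m)
      have hr : 0 < r := Real.sqrt_pos.mpr (by positivity)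
      have hr2 : r ^ 2 = 8 * m := Real.sq_sqrt (by positivity)
      have hdK : (m : ℝ) + 2 + d = 2 * K := by exact_mod_cast hd
      have hmr : (m : ℝ) * (1 / r) = r / 8 := by
        field_simp
        linarith
      have hmθ : (m : ℝ) * θ < m * (1 / 2) + r / 8 := by
        rw [← hmr, ← mul_add]
        gcongr
      have hdr : (d : ℝ) < r / 4 := by linarith
      have : 2 * (d : ℝ) ^ 2 < m := by nlinarith [Nat.cast_nonneg (α := ℝ) d]
      exact_mod_cast this
  have hmeasure := ENNReal.toReal_mono (measure_ne_top _ _)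
    (card_tail_div_le_measure_empMean hm hK)
  rw [ENNReal.toReal_mul, ENNReal.toReal_natCast, ENNReal.toReal_pow, ENNReal.toReal_inv,
    ENNReal.toReal_ofNat, inv_pow, ← div_eq_mul_inv] at hmeasure
  refine le_trans ?_ hmeasure
  rw [div_le_div_iff₀ (by norm_num) (by positivity), one_mul, mul_comm]
  exact_mod_cast hcard

/-- Non-vanishing bias away from the boundary: for `X₁, …, X_m` i.i.d. from `B(1/2)` and
`1/2 < θ < 1/2 + 1/√(8m)`, one has `2·Pr{θ̂ ≥ θ} ≥ 1/6`; equivalently the bias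
`sign(θ - 1/2) - E[sign(θ - θ̂)]` is at least `1/6`. -/
theorem wasserstein_bias_at_half (m : ℕ) (hm : 1 ≤ m) (θ : ℝ)
    (hθ₁ : 1 / 2 < θ) (hθ₂ : θ < 1 / 2 + 1 / Real.sqrt (8 * m)) :
    (1 : ℝ) / 6 ≤
        2 * ((Measure.pi fun _ : Fin m => bernoulliReal (1/2)) {X | θ ≤ empMean X}).toReal
      ∧ (1 : ℝ) / 6 ≤
        Real.sign (θ - 1/2) -
          ∫ X, Real.sign (θ - empMean X)
            ∂(Measure.pi fun _ : Fin m => bernoulliReal (1/2)) := by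
  refine ⟨by linarith [one_div_twelve_le_measure_empMean hm hθ₁ hθ₂], ?_⟩
  obtain ⟨η, hθη, hη⟩ := exists_between hθ₂
  have htail := one_div_twelve_le_measure_empMean hm (hθ₁.trans hθη) hη
  rw [Real.sign_of_pos (sub_pos.mpr hθ₁)]
  set P := Measure.pi fun _ : Fin m => bernoulliReal (1 / 2)
  by_cases hint : Integrable (fun X => Real.sign (θ - empMean X)) P
  · set E : Set (Fin m → ℝ) := {X | η ≤ empMean X}
    have hmeas : MeasurableSet E := measurableSet_le measurable_const measurable_empMean
    have hind : Integrable (E.indicator fun _ => (2 : ℝ)) P :=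
      (integrable_const 2).indicator hmeas
    have hle : ∫ X, Real.sign (θ - empMean X) ∂P ≤
        ∫ X, (1 - E.indicator (fun _ => (2 : ℝ)) X) ∂P := by
      refine integral_mono hint ((integrable_const 1).sub hind) fun X => ?_
      by_cases hX : X ∈ E
      · have hηX : η ≤ empMean X := hX
        simp only [Real.sign_of_neg (show θ - empMean X < 0 by linarith),
          Set.indicator_of_mem hX]
        norm_num
      · simp only [Set.indicator_of_notMem hX]
        rcases Real.sign_apply_eq (θ - empMean X) with h | h | h <;> rw [h] <;> norm_num
    rw [integral_sub (integrable_const 1) hind, integral_indicator_const _ hmeas,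
      integral_const, probReal_univ, smul_eq_mul, smul_eq_mul, measureReal_def] at hle
    linarith
  · rw [integral_undef hint]
    norm_num
end

section
/- Deterministic solutions to stochastic problems: let m ≥ 1 and θ* ∈ (2^{−1/m}, 1), and let X₁, …, X_m be i.i.d. with law B(θ*) and θ̂ = (1/m)∑ᵢ Xᵢ. Then for every θ ∈ [0, 1), E[|θ̂ − 1|] < E[|θ̂ − θ|]; that is, the expected sample Wasserstein loss θ ↦ E[|θ̂ − θ|] over [0,1] is uniquely minimized at θ = 1, a deterministic (zero-entropy) distribution, even though B(θ*) has nonzero entropy. -/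
open MeasureTheory

theorem integrable_id_bernoulliReal (p : ℝ) : Integrable (fun x : ℝ => x) (bernoulliReal p) :=
  ((integrable_dirac (by simp)).smul_measure ENNReal.ofReal_ne_top).add_measure
    ((integrable_dirac (by simp)).smul_measure ENNReal.ofReal_ne_top)

theorem integrable_abs_empMean_sub {m : ℕ} {μ : Measure ℝ} [IsProbabilityMeasure μ]
    (hμ : Integrable (fun x : ℝ => x) μ) (c : ℝ) :
    Integrable (fun X => |empMean X - c|) (Measure.pi fun _ : Fin m => μ) := by
  have hX (i : Fin m) : Integrable (fun X : Fin m → ℝ => X i) (Measure.pi fun _ => μ) :=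
    integrable_comp_eval (μ := fun _ : Fin m => μ) (i := i) hμ
  exact (((integrable_finsetSum _ fun i _ => hX i).div_const _).sub (integrable_const c)).abs

theorem half_lt_pow {m : ℕ} (hm : 1 ≤ m) {p : ℝ} (hp : (2 : ℝ) ^ (-(1 : ℝ) / m) < p) :
    1 / 2 < p ^ m := by
  have hm' : (m : ℝ) ≠ 0 := by positivity
  calc (1 / 2 : ℝ) = ((2 : ℝ) ^ (-(1 : ℝ) / m)) ^ m := by
        rw [← Real.rpow_natCast, ← Real.rpow_mul zero_le_two, div_mul_cancel₀ _ hm',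
          Real.rpow_neg_one, one_div]
    _ < p ^ m := pow_lt_pow_left₀ hp (by positivity) (by lia)

/-- Deterministic solutions to stochastic problems: for `θ* ∈ (2^{-1/m}, 1)` and
`X₁, …, X_m` i.i.d. from `B(θ*)`, the expected sample Wasserstein loss
`θ ↦ E[|θ̂ - θ|]` is uniquely minimized over `[0,1]` at the deterministic solution `θ = 1`:
`E[|θ̂ - 1|] < E[|θ̂ - θ|]` for every `θ ∈ [0,1)`. -/
theorem deterministic_solution (m : ℕ) (hm : 1 ≤ m) (θstar : ℝ)
    (hθstar : θstar ∈ Set.Ioo ((2 : ℝ) ^ (-(1 : ℝ) / m)) 1)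
    (θ : ℝ) (hθ : θ ∈ Set.Ico (0:ℝ) 1) :
    ∫ X, |empMean X - 1| ∂(Measure.pi fun _ : Fin m => bernoulliReal θstar)
      < ∫ X, |empMean X - θ| ∂(Measure.pi fun _ : Fin m => bernoulliReal θstar) := by
  have h0 : 0 ≤ θstar := (Real.rpow_nonneg zero_le_two _).trans hθstar.1.le
  have := isProbabilityMeasure_bernoulliReal h0 hθstar.2.le
  set μ := Measure.pi fun _ : Fin m => bernoulliReal θstar
  let A : Set (Fin m → ℝ) := Set.univ.pi fun _ => {1}
  have hA : MeasurableSet A := .univ_pi fun _ => measurableSet_singleton 1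
  have hμA : μ.real A = θstar ^ m := by
    simp [μ, A, Measure.real, Measure.pi_pi, bernoulliReal_singleton_one, h0]
  have hint (c : ℝ) : Integrable (fun X => |empMean X - c|) μ :=
    integrable_abs_empMean_sub (integrable_id_bernoulliReal θstar) c
  have hind : Integrable (A.indicator fun _ => 2 * (1 - θ)) μ :=
    (integrable_const _).indicator hA
  have hle (X : Fin m → ℝ) :
      A.indicator (fun _ => 2 * (1 - θ)) X - (1 - θ) ≤ |empMean X - θ| - |empMean X - 1| := by
    by_cases hX : X ∈ A
    · have hX1 : empMean X = 1 := by
        have hX' : ∀ i, X i = 1 := fun i => hX i trivial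
        have hm' : (m : ℝ) ≠ 0 := by positivity
        simp [empMean, hX', hm']
      rw [Set.indicator_of_mem hX, hX1, abs_of_pos (sub_pos.2 hθ.2)]
      simp only [sub_self, abs_zero]
      linarith
    · rw [Set.indicator_of_notMem hX]
      have h := abs_sub_le (empMean X) θ 1
      rw [abs_sub_comm θ 1, abs_of_pos (sub_pos.2 hθ.2)] at h
      linarith
  have key := integral_mono (hind.sub (integrable_const _)) ((hint θ).sub (hint 1)) hle
  simp only [Pi.sub_apply] at key
  rw [integral_sub hind (integrable_const _), integral_sub (hint θ) (hint 1),
    integral_indicator_const _ hA, hμA] at key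
  simp only [integral_const, probReal_univ, smul_eq_mul, one_mul] at key
  nlinarith [half_lt_pow hm hθstar.1, hθ.2]
end

section
/- Sum invariance of the l_p distances: let P, Q, R be probability measures on ℝ and let P∗R and Q∗R denote convolutions. Then for every p ∈ [1, ∞), ∫_ℝ |F_{P∗R}(x) − F_{Q∗R}(x)|^p dx ≤ ∫_ℝ |F_P(x) − F_Q(x)|^p dx (as an inequality of Lebesgue integrals with values in [0, ∞]). In particular, l_p(A + X, A + Y) ≤ l_p(X, Y) whenever A is independent of X and Y. -/
open MeasureTheory

/-- The cumulative distribution function of a measure on `ℝ`. -/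
noncomputable def cdf' (P : Measure ℝ) (x : ℝ) : ℝ :=
  (P (Set.Iic x)).toReal

lemma monotone_cdf' (P : Measure ℝ) [IsFiniteMeasure P] : Monotone (cdf' P) := fun _ _ h =>
  ENNReal.toReal_mono (measure_ne_top _ _) (measure_mono (Set.Iic_subset_Iic.2 h))

lemma measurable_cdf' (P : Measure ℝ) [IsFiniteMeasure P] : Measurable (cdf' P) :=
  (monotone_cdf' P).measurable

lemma cdf'_nonneg (P : Measure ℝ) (x : ℝ) : 0 ≤ cdf' P x := ENNReal.toReal_nonneg

lemma cdf'_le_one (P : Measure ℝ) [IsProbabilityMeasure P] (x : ℝ) : cdf' P x ≤ 1 :=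
  measureReal_le_one

lemma abs_cdf'_sub_le_one (P Q : Measure ℝ) [IsProbabilityMeasure P] [IsProbabilityMeasure Q]
    (x : ℝ) : |cdf' P x - cdf' Q x| ≤ 1 :=
  abs_sub_le_iff.2 ⟨by linarith [cdf'_le_one P x, cdf'_nonneg Q x],
    by linarith [cdf'_le_one Q x, cdf'_nonneg P x]⟩

/-- The distribution function of a convolution averages the translates of the distribution
function of the first factor. -/
lemma cdf'_conv (P R : Measure ℝ) [IsFiniteMeasure P] [IsFiniteMeasure R] (x : ℝ) :
    cdf' (Measure.conv P R) x = ∫ a, cdf' P (x - a) ∂ R := by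
  have hm : Measurable fun a => P (Set.Iic (x - a)) :=
    Antitone.measurable fun a b h => measure_mono (Set.Iic_subset_Iic.2 (by linarith))
  unfold cdf'
  rw [integral_toReal hm.aemeasurable (ae_of_all _ fun _ => measure_lt_top _ _), Measure.conv,
    Measure.map_apply measurable_add measurableSet_Iic,
    Measure.prod_apply_symm (measurable_add measurableSet_Iic)]
  congr 2 with a
  congr 1
  ext y
  simp [le_sub_iff_add_le]

/-- Jensen's inequality for `|·| ^ p` and a bounded function. -/
lemma abs_integral_rpow_le {α : Type*} [MeasurableSpace α] (μ : Measure α)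
    [IsProbabilityMeasure μ] {f : α → ℝ} (hf : Measurable f) {C : ℝ} (hC : ∀ a, |f a| ≤ C)
    {p : ℝ} (hp : 1 ≤ p) :
    ENNReal.ofReal (|∫ a, f a ∂μ| ^ p) ≤ ∫⁻ a, ENNReal.ofReal (|f a| ^ p) ∂μ := by
  have hp0 : 0 ≤ p := by linarith
  have hi : Integrable (fun a => |f a|) μ :=
    .of_bound (by fun_prop) C (ae_of_all _ fun a => by simpa using hC a)
  have hip : Integrable (fun a => |f a| ^ p) μ :=
    .of_bound (by fun_prop) (C ^ p) (ae_of_all _ fun a => by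
      rw [Real.norm_of_nonneg (by positivity)]
      exact Real.rpow_le_rpow (abs_nonneg _) (hC a) hp0)
  rw [← ofReal_integral_eq_lintegral_ofReal hip (ae_of_all _ fun a => by positivity)]
  refine ENNReal.ofReal_le_ofReal ?_
  calc |∫ a, f a ∂μ| ^ p ≤ (∫ a, |f a| ∂μ) ^ p :=
        Real.rpow_le_rpow (abs_nonneg _) abs_integral_le_integral_abs hp0
    _ ≤ ∫ a, |f a| ^ p ∂μ :=
        (convexOn_rpow hp).map_integral_le
          (Real.continuous_rpow_const hp0).continuousOn isClosed_Ici
          (ae_of_all _ fun a => abs_nonneg (f a)) hi hip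

/-- Sum invariance of the `l_p` distances: convolving both `P` and `Q` with `R` does not
increase `∫ |F_P - F_Q|^p`; hence `l_p(A + X, A + Y) ≤ l_p(X, Y)` for `A` independent of
`X` and `Y`. -/
theorem lp_sum_invariant (P Q R : Measure ℝ)
    [IsProbabilityMeasure P] [IsProbabilityMeasure Q] [IsProbabilityMeasure R]
    (p : ℝ) (hp : 1 ≤ p) :
    ∫⁻ x, ENNReal.ofReal (|cdf' (Measure.conv P R) x - cdf' (Measure.conv Q R) x| ^ p)
      ≤ ∫⁻ x, ENNReal.ofReal (|cdf' P x - cdf' Q x| ^ p) := by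
  have hP := measurable_cdf' P
  have hQ := measurable_cdf' Q
  have hint (S : Measure ℝ) [IsProbabilityMeasure S] (x : ℝ) :
      Integrable (fun a => cdf' S (x - a)) R :=
    .of_bound ((measurable_cdf' S).comp (by fun_prop)).aestronglyMeasurable 1
      (ae_of_all _ fun a => by
        rw [Real.norm_of_nonneg (cdf'_nonneg _ _)]; exact cdf'_le_one _ _)
  calc ∫⁻ x, ENNReal.ofReal (|cdf' (Measure.conv P R) x - cdf' (Measure.conv Q R) x| ^ p)
      ≤ ∫⁻ x, ∫⁻ a, ENNReal.ofReal (|cdf' P (x - a) - cdf' Q (x - a)| ^ p) ∂ R := by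
        refine lintegral_mono fun x => ?_
        rw [cdf'_conv, cdf'_conv, ← integral_sub (hint P x) (hint Q x)]
        exact abs_integral_rpow_le R (by fun_prop)
          (fun a => abs_cdf'_sub_le_one P Q (x - a)) hp
    _ = ∫⁻ a, ∫⁻ x, ENNReal.ofReal (|cdf' P (x - a) - cdf' Q (x - a)| ^ p) ∂volume ∂ R :=
        lintegral_lintegral_swap (by fun_prop)
    _ = ∫⁻ x, ENNReal.ofReal (|cdf' P x - cdf' Q x| ^ p) := by
        simp_rw [lintegral_sub_right_eq_self
          (fun x => ENNReal.ofReal (|cdf' P x - cdf' Q x| ^ p))]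
        simp
end

section
/- Equivalence of the Cramér distance and one half of the energy distance in one dimension: let P, Q be probability measures on ℝ with finite first moments, and let X, X′ ∼ P and Y, Y′ ∼ Q be independent. Then ∫_ℝ (F_P(x) − F_Q(x))² dx = E‖X − Y‖ − (1/2)E‖X − X′‖ − (1/2)E‖Y − Y′‖, i.e. l₂²(P, Q) = (1/2)𝓔(P, Q). -/
open MeasureTheory

/-- The Cramér kernel of two measures on `ℝ` is integrable over the line, with integral the
expected distance between independent samples. -/
theorem integrable_cdf'_and_integral_eq (P Q : Measure ℝ)
    [IsProbabilityMeasure P] [IsProbabilityMeasure Q]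
    (hP : Integrable (fun x : ℝ => x) P) (hQ : Integrable (fun x : ℝ => x) Q) :
    Integrable (fun t => cdf' P t * (1 - cdf' Q t) + cdf' Q t * (1 - cdf' P t)) ∧
      ∫ t, (cdf' P t * (1 - cdf' Q t) + cdf' Q t * (1 - cdf' P t))
        = ∫ z : ℝ × ℝ, |z.1 - z.2| ∂(P.prod Q) := by
  let k : (ℝ × ℝ) → ℝ → ℝ := fun z =>
    (Set.Ico (min z.1 z.2) (max z.1 z.2)).indicator fun _ => 1
  have k_eq (z : ℝ × ℝ) (t : ℝ) : k z t =
      (Set.Iic t).indicator (fun _ => 1) z.1 * (1 - (Set.Iic t).indicator (fun _ => 1) z.2)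
        + (1 - (Set.Iic t).indicator (fun _ => 1) z.1)
          * (Set.Iic t).indicator (fun _ => 1) z.2 := by
    by_cases h₁ : z.1 ≤ t <;> by_cases h₂ : z.2 ≤ t <;>
      simp [k, Set.indicator, h₁, h₂, not_lt.mpr, lt_of_not_ge]
  have k_integral (z : ℝ × ℝ) : ∫ t, k z t = |z.1 - z.2| := by
    simp [k, integral_indicator, measurableSet_Ico, max_sub_min_eq_abs, abs_sub_comm]
  have k_nonneg (z : ℝ × ℝ) (t : ℝ) : 0 ≤ k z t :=
    Set.indicator_nonneg (fun _ _ => zero_le_one) t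
  have k_meas : Measurable (Function.uncurry k) := by
    have hs : MeasurableSet {p : (ℝ × ℝ) × ℝ | min p.1.1 p.1.2 ≤ p.2 ∧ p.2 < max p.1.1 p.1.2} :=
      MeasurableSet.inter (measurableSet_le (f := fun p : (ℝ × ℝ) × ℝ => min p.1.1 p.1.2)
          (by fun_prop) measurable_snd)
        (measurableSet_lt (g := fun p : (ℝ × ℝ) × ℝ => max p.1.1 p.1.2) measurable_snd
          (by fun_prop))
    exact (measurable_const (a := (1 : ℝ))).indicator hs
  have k_int : Integrable (Function.uncurry k) ((P.prod Q).prod volume) := by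
    refine (integrable_prod_iff k_meas.aestronglyMeasurable).mpr ⟨.of_forall fun z => ?_, ?_⟩
    · have h : IntegrableOn (fun _ : ℝ => (1 : ℝ)) (Set.Ico (min z.1 z.2) (max z.1 z.2)) :=
        integrableOn_const measure_Ico_lt_top.ne
      exact h.integrable_indicator measurableSet_Ico
    · simp only [Function.uncurry_apply_pair, Real.norm_of_nonneg (k_nonneg _ _), k_integral]
      exact ((hP.comp_fst Q).sub (hQ.comp_snd P)).abs
  have ind_int (μ : Measure ℝ) [IsProbabilityMeasure μ] (t : ℝ) :
      Integrable ((Set.Iic t).indicator fun _ => (1 : ℝ)) μ :=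
    (integrable_const 1).indicator measurableSet_Iic
  have ind_integral (μ : Measure ℝ) [IsProbabilityMeasure μ] (t : ℝ) :
      ∫ x, (Set.Iic t).indicator (fun _ => (1 : ℝ)) x ∂μ = cdf' μ t := by
    simp [integral_indicator, measurableSet_Iic, cdf', Measure.real]
  have compl_int (μ : Measure ℝ) [IsProbabilityMeasure μ] (t : ℝ) :
      Integrable (fun x => 1 - (Set.Iic t).indicator (fun _ => (1 : ℝ)) x) μ :=
    (integrable_const 1).sub (ind_int μ t)
  have compl_integral (μ : Measure ℝ) [IsProbabilityMeasure μ] (t : ℝ) :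
      ∫ x, (1 - (Set.Iic t).indicator (fun _ => (1 : ℝ)) x) ∂μ = 1 - cdf' μ t := by
    rw [integral_sub (integrable_const 1) (ind_int μ t), ind_integral]
    simp
  have k_cdf (t : ℝ) : ∫ z, k z t ∂(P.prod Q)
      = cdf' P t * (1 - cdf' Q t) + cdf' Q t * (1 - cdf' P t) := by
    simp only [k_eq]
    rw [integral_add ((ind_int P t).mul_prod (compl_int Q t))
        ((compl_int P t).mul_prod (ind_int Q t)),
      integral_prod_mul ((Set.Iic t).indicator fun _ => (1 : ℝ))
        (fun y => 1 - (Set.Iic t).indicator (fun _ => (1 : ℝ)) y),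
      integral_prod_mul (fun x => 1 - (Set.Iic t).indicator (fun _ => (1 : ℝ)) x)
        ((Set.Iic t).indicator fun _ => (1 : ℝ)),
      ind_integral, ind_integral, compl_integral, compl_integral]
    ring
  constructor
  · simpa only [Function.uncurry_apply_pair, k_cdf] using k_int.integral_prod_right
  · simpa only [k_cdf, k_integral] using (integral_integral_swap k_int).symm

/-- The Cramér distance equals one half of the energy distance in one dimension:
for `P, Q` with finite first moments and independent `X, X' ∼ P`, `Y, Y' ∼ Q`,
`∫ (F_P - F_Q)² = E|X - Y| - (1/2) E|X - X'| - (1/2) E|Y - Y'|`. -/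
theorem cramer_eq_half_energy (P Q : Measure ℝ)
    [IsProbabilityMeasure P] [IsProbabilityMeasure Q]
    (hP : Integrable (fun x : ℝ => x) P) (hQ : Integrable (fun x : ℝ => x) Q) :
    ∫ x, (cdf' P x - cdf' Q x) ^ 2
      = (∫ z : ℝ × ℝ, |z.1 - z.2| ∂(P.prod Q))
        - (1 / 2) * (∫ z : ℝ × ℝ, |z.1 - z.2| ∂(P.prod P))
        - (1 / 2) * (∫ z : ℝ × ℝ, |z.1 - z.2| ∂(Q.prod Q)) := by
  obtain ⟨intPQ, hPQ⟩ := integrable_cdf'_and_integral_eq P Q hP hQ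
  obtain ⟨intPP, hPP⟩ := integrable_cdf'_and_integral_eq P P hP hP
  obtain ⟨intQQ, hQQ⟩ := integrable_cdf'_and_integral_eq Q Q hQ hQ
  rw [← hPQ, ← hPP, ← hQQ, ← integral_const_mul, ← integral_const_mul,
    ← integral_sub intPQ (intPP.const_mul _),
    ← integral_sub (by exact intPQ.sub (intPP.const_mul _)) (intQQ.const_mul _)]
  congr 1 with x
  ring
end

section
/- Differentiation of the 1-Wasserstein loss (first part of the consistency theorem): let F_P : ℝ → ℝ be measurable, let G : ℝ × ℝ → ℝ, let θ₀ ∈ ℝ, and suppose: (i) there exist δ > 0 and a Lebesgue-integrable function M : ℝ → [0, ∞) such that for every x, the map θ ↦ G(θ, x) is differentiable on (θ₀ − δ, θ₀ + δ) with |∂_θ G(θ, x)| ≤ M(x) for all θ in this interval; (ii) x ↦ |F_P(x) − G(θ, x)| is Lebesgue-integrable for all θ ∈ (θ₀ − δ, θ₀ + δ); (iii) the set {x : F_P(x) = G(θ₀, x)} has Lebesgue measure zero. Then the map θ ↦ ∫_ℝ |F_P(x) − G(θ, x)| dx is differentiable at θ₀ with derivative ∫_ℝ sign(G(θ₀, x)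 − F_P(x)) · ∂_θ G(θ₀, x) dx. -/
open MeasureTheory

/-- Chain rule for `t ↦ |a - f t|` away from the zeros of `a - f`. -/
theorem HasDerivAt.abs_const_sub {f : ℝ → ℝ} {f' a t : ℝ} (hf : HasDerivAt f f' t)
    (h : a ≠ f t) : HasDerivAt (fun s => |a - f s|) (Real.sign (f t - a) * f') t := by
  rcases lt_or_gt_of_ne h with h | h
  · rw [Real.sign_of_pos (sub_pos.2 h)]
    refine ((hasDerivAt_abs_neg (sub_neg.2 h)).comp t (hf.const_sub a)).congr_deriv ?_
    ring
  · rw [Real.sign_of_neg (sub_neg.2 h)]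
    refine ((hasDerivAt_abs_pos (sub_pos.2 h)).comp t (hf.const_sub a)).congr_deriv ?_
    ring

/-- The pointwise a.e. derivative of a family of a.e. strongly measurable functions is
a.e. strongly measurable. -/
theorem aestronglyMeasurable_of_hasDerivAt {α : Type*} [MeasurableSpace α] {μ : Measure α}
    {f : ℝ → α → ℝ} {f' : α → ℝ} {t : ℝ}
    (hf : ∀ᶠ s in nhds t, AEStronglyMeasurable (f s) μ)
    (hd : ∀ᵐ x ∂μ, HasDerivAt (fun s => f s x) (f' x) t) : AEStronglyMeasurable f' μ := by
  obtain ⟨δ, hδ, hball⟩ := Metric.eventually_nhds_iff.1 hf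
  obtain ⟨u, -, hu, hlim⟩ := exists_seq_strictAnti_tendsto' hδ
  have hlim' : Filter.Tendsto u Filter.atTop (nhdsWithin 0 {0}ᶜ) :=
    tendsto_nhdsWithin_iff.2 ⟨hlim, .of_forall fun n => (hu n).1.ne'⟩
  refine aestronglyMeasurable_of_tendsto_ae Filter.atTop
    (f := fun n x => (u n)⁻¹ • (f (t + u n) x - f t x)) (fun n => ?_) ?_
  · refine AEStronglyMeasurable.const_smul ((hball ?_).sub (hball ?_)) (u n)⁻¹
    · simpa [Real.dist_eq, abs_of_pos (hu n).1] using (hu n).2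
    · simpa using hδ
  · filter_upwards [hd] with x hx
    exact hx.tendsto_slope_zero.comp hlim'

/-- Differentiation of the 1-Wasserstein loss: if `G(θ, ·)` plays the role of the
distribution function of a parametrized model `Q_θ`, is differentiable in `θ` near `θ₀` with
derivative dominated by an integrable function, `x ↦ |F_P(x) - G(θ, x)|` is integrable near
`θ₀`, and `{x : F_P(x) = G(θ₀, x)}` has Lebesgue measure zero, then
`θ ↦ ∫ |F_P(x) - G(θ, x)| dx` is differentiable at `θ₀` with derivative
`∫ sign(G(θ₀, x) - F_P(x)) ∂_θ G(θ₀, x) dx`. -/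
theorem w1_loss_hasDerivAt (F : ℝ → ℝ) (hF : Measurable F) (G : ℝ → ℝ → ℝ) (θ₀ : ℝ)
    (h : ∃ δ : ℝ, 0 < δ ∧ ∃ M : ℝ → ℝ, Integrable M ∧ (∀ x, 0 ≤ M x) ∧
      (∀ x, ∀ θ ∈ Set.Ioo (θ₀ - δ) (θ₀ + δ),
        DifferentiableAt ℝ (fun t => G t x) θ ∧ |deriv (fun t => G t x) θ| ≤ M x) ∧
      (∀ θ ∈ Set.Ioo (θ₀ - δ) (θ₀ + δ), Integrable (fun x => |F x - G θ x|)))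
    (hzero : volume {x : ℝ | F x = G θ₀ x} = 0) :
    HasDerivAt (fun θ => ∫ x, |F x - G θ x|)
      (∫ x, Real.sign (G θ₀ x - F x) * deriv (fun t => G t x) θ₀) θ₀ := by
  obtain ⟨δ, hδ, M, hM, hM0, hG, hint⟩ := h
  have hnhds : Set.Ioo (θ₀ - δ) (θ₀ + δ) ∈ nhds θ₀ :=
    Ioo_mem_nhds (by linarith) (by linarith)
  have hmeas : ∀ᶠ θ in nhds θ₀, AEStronglyMeasurable (fun x => |F x - G θ x|) volume :=
    Filter.eventually_of_mem hnhds fun θ hθ => (hint θ hθ).aestronglyMeasurable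
  have hderiv : ∀ᵐ x, HasDerivAt (fun θ => |F x - G θ x|)
      (Real.sign (G θ₀ x - F x) * deriv (fun t => G t x) θ₀) θ₀ := by
    have hne : ∀ᵐ x, F x ≠ G θ₀ x := by simpa [ae_iff] using hzero
    filter_upwards [hne] with x hx
    exact (hG x θ₀ (mem_of_mem_nhds hnhds)).1.hasDerivAt.abs_const_sub hx
  refine (hasDerivAt_integral_of_dominated_loc_of_lip hnhds hmeas
    (hint θ₀ (mem_of_mem_nhds hnhds)) (aestronglyMeasurable_of_hasDerivAt hmeas hderiv)
    (.of_forall fun x => ?_) hM hderiv).2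
  refine LipschitzOnWith.of_dist_le_mul fun a ha b hb => ?_
  have hmv := (convex_Ioo (θ₀ - δ) (θ₀ + δ)).norm_image_sub_le_of_norm_deriv_le
    (fun θ hθ => (hG x θ hθ).1) (fun θ hθ => (hG x θ hθ).2) hb ha
  rw [Real.coe_nnabs, abs_of_nonneg (hM0 x), Real.dist_eq, Real.dist_eq]
  refine (abs_abs_sub_abs_le _ _).trans ?_
  rw [sub_sub_sub_cancel_left, abs_sub_comm]
  exact hmv
end
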